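/- arXiv:2307.01518 — 2 statements merged into one kernel-verified Lean document; each statement's English description precedes it below -/
import Mathlib

section
/- (Dissipativity of the energy derivative.) For every t ∈ (0,T), dE(t)/dt ≤ 0; that is, the energy E is nonincreasing on [0,T]. -/
open Set intervalIntegral

noncomputable def pdx (u : ℝ → ℝ → ℝ) (x t : ℝ) : ℝ := deriv (fun y => u y t) x
noncomputable def pdt (u : ℝ → ℝ → ℝ) (x t : ℝ) : ℝ := deriv (fun s => u x s) t

noncomputable def beamEnergy (m r : ℝ → ℝ) (krm krp ℓ : ℝ) (u : ℝ → ℝ → ℝ) (t : ℝ) : ℝ :=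
  (1/2) * (∫ x in (0:ℝ)..ℓ, (m x * (pdt u x t)^2 + r x * (pdx (pdx u) x t)^2))
    + (1/2) * krm * (pdx u 0 t)^2 + (1/2) * krp * (pdx u ℓ t)^2

open Topology MeasureTheory in
/-- Differentiation under the integral sign over a compact interval, with a continuous weight. -/
theorem hasDerivAt_integral_weight_mul {a b : ℝ} (hab : a ≤ b) {g : ℝ → ℝ}
    (hg : ContinuousOn g (Icc a b)) {F F' : ℝ → ℝ → ℝ}
    (hF : Continuous (Function.uncurry F)) (hF' : Continuous (Function.uncurry F'))
    (hd : ∀ x t, HasDerivAt (fun s => F x s) (F' x t) t) (t : ℝ) :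
    HasDerivAt (fun s => ∫ x in a..b, g x * F x s) (∫ x in a..b, g x * F' x t) t := by
  have slice : ∀ {G : ℝ → ℝ → ℝ}, Continuous (Function.uncurry G) → ∀ s,
      IntervalIntegrable (fun x => g x * G x s) volume a b := fun {G} hG s => by
    apply ContinuousOn.intervalIntegrable_of_Icc hab
    exact hg.mul (hG.comp (by fun_prop : Continuous fun x : ℝ => (x, s))).continuousOn
  obtain ⟨C, hC⟩ := (isCompact_Icc.prod (isCompact_closedBall t 1)).exists_bound_of_continuousOn
    (s := Icc a b ×ˢ Metric.closedBall t 1) (f := fun p : ℝ × ℝ => g p.1 * F' p.1 p.2)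
    ((hg.comp continuousOn_fst fun p hp => hp.1).mul hF'.continuousOn)
  refine (intervalIntegral.hasDerivAt_integral_of_dominated_loc_of_deriv_le
    (F := fun s x => g x * F x s) (F' := fun s x => g x * F' x s) (bound := fun _ => C)
    (Metric.closedBall_mem_nhds t one_pos)
    (Filter.Eventually.of_forall fun s => (intervalIntegrable_iff.1 (slice hF s)).aestronglyMeasurable)
    (slice hF t)
    (intervalIntegrable_iff.1 (slice hF' t)).aestronglyMeasurable ?_ intervalIntegrable_const ?_).2
  · refine Filter.Eventually.of_forall fun x hx s hs => hC (x, s) ⟨?_, hs⟩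
    rw [uIoc_of_le hab] at hx
    exact Ioc_subset_Icc_self hx
  · exact Filter.Eventually.of_forall fun x _ s _ => (hd x s).const_mul (g x)

section PartialDerivatives

variable {v : ℝ → ℝ → ℝ}

theorem hasDerivAt_fderiv_left (hv : Differentiable ℝ (Function.uncurry v)) (x t : ℝ) :
    HasDerivAt (fun y => v y t) (fderiv ℝ (Function.uncurry v) (x, t) (1, 0)) x :=
  (hv (x, t)).hasFDerivAt.comp_hasDerivAt (f := fun y => (y, t)) x (
    (hasDerivAt_id x).prodMk (hasDerivAt_const x t))

theorem hasDerivAt_fderiv_right (hv : Differentiable ℝ (Function.uncurry v)) (x t : ℝ) :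
    HasDerivAt (fun s => v x s) (fderiv ℝ (Function.uncurry v) (x, t) (0, 1)) t :=
  (hv (x, t)).hasFDerivAt.comp_hasDerivAt (f := fun s => (x, s)) t (
    (hasDerivAt_const t x).prodMk (hasDerivAt_id t))

theorem pdx_eq_fderiv (hv : Differentiable ℝ (Function.uncurry v)) (x t : ℝ) :
    pdx v x t = fderiv ℝ (Function.uncurry v) (x, t) (1, 0) :=
  (hasDerivAt_fderiv_left hv x t).deriv

theorem pdt_eq_fderiv (hv : Differentiable ℝ (Function.uncurry v)) (x t : ℝ) :
    pdt v x t = fderiv ℝ (Function.uncurry v) (x, t) (0, 1) :=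
  (hasDerivAt_fderiv_right hv x t).deriv

theorem hasDerivAt_pdx (hv : Differentiable ℝ (Function.uncurry v)) (x t : ℝ) :
    HasDerivAt (fun y => v y t) (pdx v x t) x :=
  (hasDerivAt_fderiv_left hv x t).differentiableAt.hasDerivAt

theorem hasDerivAt_pdt (hv : Differentiable ℝ (Function.uncurry v)) (x t : ℝ) :
    HasDerivAt (fun s => v x s) (pdt v x t) t :=
  (hasDerivAt_fderiv_right hv x t).differentiableAt.hasDerivAt

theorem contDiff_pdx (hv : ContDiff ℝ (⊤ : ℕ∞) (Function.uncurry v)) :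
    ContDiff ℝ (⊤ : ℕ∞) (Function.uncurry (pdx v)) := by
  have h : Function.uncurry (pdx v) = fun p => fderiv ℝ (Function.uncurry v) p (1, 0) :=
    funext fun p => pdx_eq_fderiv (hv.differentiable (by simp)) p.1 p.2
  rw [h]
  exact (hv.fderiv_right (by simp)).clm_apply contDiff_const

theorem contDiff_pdt (hv : ContDiff ℝ (⊤ : ℕ∞) (Function.uncurry v)) :
    ContDiff ℝ (⊤ : ℕ∞) (Function.uncurry (pdt v)) := by
  have h : Function.uncurry (pdt v) = fun p => fderiv ℝ (Function.uncurry v) p (0, 1) :=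
    funext fun p => pdt_eq_fderiv (hv.differentiable (by simp)) p.1 p.2
  rw [h]
  exact (hv.fderiv_right (by simp)).clm_apply contDiff_const

theorem pdt_pdx_comm (hv : ContDiff ℝ (⊤ : ℕ∞) (Function.uncurry v)) :
    pdt (pdx v) = pdx (pdt v) := by
  have hv1 : Differentiable ℝ (Function.uncurry v) := hv.differentiable (by simp)
  have hd : Differentiable ℝ (fderiv ℝ (Function.uncurry v)) :=
    (hv.fderiv_right (m := 1) (by norm_cast)).differentiable (by simp)
  have hx : Function.uncurry (pdx v) = fun p => fderiv ℝ (Function.uncurry v) p (1, 0) :=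
    funext fun p => pdx_eq_fderiv hv1 p.1 p.2
  have ht : Function.uncurry (pdt v) = fun p => fderiv ℝ (Function.uncurry v) p (0, 1) :=
    funext fun p => pdt_eq_fderiv hv1 p.1 p.2
  ext x t
  rw [pdt_eq_fderiv ((contDiff_pdx hv).differentiable (by simp)),
    pdx_eq_fderiv ((contDiff_pdt hv).differentiable (by simp)), hx, ht,
    fderiv_clm_apply (hd _) (differentiableAt_const _),
    fderiv_clm_apply (hd _) (differentiableAt_const _)]
  simpa using (hv.contDiffAt.isSymmSndFDerivAt (x := (x, t))
    (by simpa using WithTop.coe_le_coe.2 (le_top : (2 : ℕ∞) ≤ ⊤))).eq (0, 1) (1, 0)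

theorem continuous_slice (hv : ContDiff ℝ (⊤ : ℕ∞) (Function.uncurry v)) (t : ℝ) :
    Continuous fun x => v x t :=
  hv.continuous.comp (by fun_prop : Continuous fun x : ℝ => (x, t))

/-- Green's identity for the second `x`-derivative. -/
theorem integral_mul_pdx_pdx_sub {w q : ℝ → ℝ → ℝ}
    (hw : ContDiff ℝ (⊤ : ℕ∞) (Function.uncurry w))
    (hq : ContDiff ℝ (⊤ : ℕ∞) (Function.uncurry q)) (a b t : ℝ) :
    (∫ x in a..b, w x t * pdx (pdx q) x t) =
      (w b t * pdx q b t - w a t * pdx q a t) - (pdx w b t * q b t - pdx w a t * q a t)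
        + ∫ x in a..b, pdx (pdx w) x t * q x t := by
  have parts : ∀ {f g : ℝ → ℝ → ℝ}, ContDiff ℝ (⊤ : ℕ∞) (Function.uncurry f) →
      ContDiff ℝ (⊤ : ℕ∞) (Function.uncurry g) →
      ∫ x in a..b, f x t * pdx g x t =
        f b t * g b t - f a t * g a t - ∫ x in a..b, pdx f x t * g x t := fun hf hg =>
    integral_mul_deriv_eq_deriv_mul
      (fun x _ => hasDerivAt_pdx (hf.differentiable (by simp)) x t)
      (fun x _ => hasDerivAt_pdx (hg.differentiable (by simp)) x t)
      ((continuous_slice (contDiff_pdx hf) t).intervalIntegrable a b)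
      ((continuous_slice (contDiff_pdx hg) t).intervalIntegrable a b)
  rw [parts hw (contDiff_pdx hq), parts (contDiff_pdx hw) hq]
  ring

end PartialDerivatives

theorem hasDerivAt_beamEnergy {m r : ℝ → ℝ} {ℓ : ℝ} {u : ℝ → ℝ → ℝ} (krm krp : ℝ) (hℓ : 0 ≤ ℓ)
    (hm : ContinuousOn m (Icc 0 ℓ)) (hr : ContinuousOn r (Icc 0 ℓ))
    (hu : ContDiff ℝ (⊤ : ℕ∞) (Function.uncurry u)) (t : ℝ) :
    HasDerivAt (beamEnergy m r krm krp ℓ u)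
      ((∫ x in (0:ℝ)..ℓ, m x * (pdt u x t * pdt (pdt u) x t))
        + (∫ x in (0:ℝ)..ℓ, r x * (pdx (pdx u) x t * pdt (pdx (pdx u)) x t))
        + krm * (pdx u 0 t * pdt (pdx u) 0 t) + krp * (pdx u ℓ t * pdt (pdx u) ℓ t)) t := by
  have hsq : ∀ {v : ℝ → ℝ → ℝ}, ContDiff ℝ (⊤ : ℕ∞) (Function.uncurry v) → ∀ x s,
      HasDerivAt (fun s => v x s ^ 2) (2 * (v x s * pdt v x s)) s := fun hv x s =>
    ((hasDerivAt_pdt (hv.differentiable (by simp)) x s).fun_pow 2).congr_deriv (by ring)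
  have hint : ∀ {g : ℝ → ℝ} {v : ℝ → ℝ → ℝ}, ContinuousOn g (Icc 0 ℓ) →
      ContDiff ℝ (⊤ : ℕ∞) (Function.uncurry v) →
      HasDerivAt (fun s => ∫ x in (0:ℝ)..ℓ, g x * v x s ^ 2)
        (2 * ∫ x in (0:ℝ)..ℓ, g x * (v x t * pdt v x t)) t := fun {g v} hg hv => by
    convert hasDerivAt_integral_weight_mul hℓ hg (F := fun x s => v x s ^ 2)
      (F' := fun x s => 2 * (v x s * pdt v x s)) (hv.continuous.fun_pow 2)
      (continuous_const.fun_mul (hv.continuous.fun_mul (contDiff_pdt hv).continuous)) (hsq hv) t using 1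
    rw [← intervalIntegral.integral_const_mul]
    exact integral_congr fun x _ => by ring
  have hii : ∀ {g : ℝ → ℝ} {v : ℝ → ℝ → ℝ}, ContinuousOn g (Icc 0 ℓ) →
      ContDiff ℝ (⊤ : ℕ∞) (Function.uncurry v) → ∀ s,
      IntervalIntegrable (fun x => g x * v x s ^ 2) MeasureTheory.volume 0 ℓ :=
    fun hg hv s => (hg.mul ((continuous_slice hv s).pow 2).continuousOn).intervalIntegrable_of_Icc hℓ
  have hxx := contDiff_pdx (contDiff_pdx hu)
  have hE : beamEnergy m r krm krp ℓ u = fun s =>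
      (1/2) * ((∫ x in (0:ℝ)..ℓ, m x * pdt u x s ^ 2)
        + ∫ x in (0:ℝ)..ℓ, r x * pdx (pdx u) x s ^ 2)
      + (1/2) * krm * pdx u 0 s ^ 2 + (1/2) * krp * pdx u ℓ s ^ 2 := by
    ext s
    rw [beamEnergy, intervalIntegral.integral_add (hii hm (contDiff_pdt hu) s) (hii hr hxx s)]
  rw [hE]
  exact (((((hint hm (contDiff_pdt hu)).fun_add (hint hr hxx)).const_mul (1/2)).fun_add
    ((hsq (contDiff_pdx hu) 0 t).const_mul ((1/2) * krm))).fun_add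
    ((hsq (contDiff_pdx hu) ℓ t).const_mul ((1/2) * krp))).congr_deriv (by ring)

theorem energy_dissipative
    (ℓ T m₀ m₁ μ₀ μ₁ r₀ r₁ krm kam krp kap : ℝ)
    (m μ r : ℝ → ℝ) (u : ℝ → ℝ → ℝ)
    (hℓ : 0 < ℓ) (hT : 0 < T)
    (hm₀ : 0 < m₀) (hμ₀ : 0 ≤ μ₀) (hr₀ : 0 < r₀)
    (hmc : ContinuousOn m (Icc 0 ℓ)) (hμc : ContinuousOn μ (Icc 0 ℓ))
    (hrc : ContinuousOn r (Icc 0 ℓ))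
    (hmb : ∀ x ∈ Icc 0 ℓ, m₀ ≤ m x ∧ m x ≤ m₁)
    (hμb : ∀ x ∈ Icc 0 ℓ, μ₀ ≤ μ x ∧ μ x ≤ μ₁)
    (hrb : ∀ x ∈ Icc 0 ℓ, r₀ ≤ r x ∧ r x ≤ r₁)
    (hkrm : 0 ≤ krm) (hkam : 0 ≤ kam) (hkrp : 0 ≤ krp) (hkap : 0 ≤ kap)
    (hu : ContDiff ℝ (⊤ : ℕ∞) (Function.uncurry u))
    (hq : ContDiff ℝ (⊤ : ℕ∞) (Function.uncurry (fun x t => r x * pdx (pdx u) x t)))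
    (hpde : ∀ x ∈ Ioo 0 ℓ, ∀ t ∈ Ioo 0 T,
      m x * pdt (pdt u) x t + μ x * pdt u x t
        + pdx (pdx (fun y s => r y * pdx (pdx u) y s)) x t = 0)
    (hbu0 : ∀ t ∈ Icc 0 T, u 0 t = 0)
    (hbuℓ : ∀ t ∈ Icc 0 T, u ℓ t = 0)
    (hbm0 : ∀ t ∈ Icc 0 T,
      -(r 0 * pdx (pdx u) 0 t) = -(krm * pdx u 0 t) - kam * pdt (pdx u) 0 t)
    (hbmℓ : ∀ t ∈ Icc 0 T,
      -(r ℓ * pdx (pdx u) ℓ t) = krp * pdx u ℓ t + kap * pdt (pdx u) ℓ t) :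
    (∀ t ∈ Ioo 0 T, ∃ d, HasDerivAt (beamEnergy m r krm krp ℓ u) d t ∧ d ≤ 0) ∧
      AntitoneOn (beamEnergy m r krm krp ℓ u) (Icc 0 T) := by
  have key := hasDerivAt_beamEnergy krm krp hℓ.le hmc hrc hu
  have hut := contDiff_pdt hu
  have main : ∀ t ∈ Ioo 0 T, (∫ x in (0:ℝ)..ℓ, m x * (pdt u x t * pdt (pdt u) x t))
        + (∫ x in (0:ℝ)..ℓ, r x * (pdx (pdx u) x t * pdt (pdx (pdx u)) x t))
        + krm * (pdx u 0 t * pdt (pdx u) 0 t) + krp * (pdx u ℓ t * pdt (pdx u) ℓ t) ≤ 0 := by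
    intro t ht
    have velocity_zero : ∀ y, (∀ s ∈ Icc 0 T, u y s = 0) → pdt u y t = 0 := fun y hy => by
      have h : (fun s => u y s) =ᶠ[nhds t] fun _ => (0 : ℝ) := by
        filter_upwards [Icc_mem_nhds ht.1 ht.2] with s hs using hy s hs
      rw [pdt, h.deriv_eq, deriv_const]
    have h1 : ∫ x in (0:ℝ)..ℓ, m x * (pdt u x t * pdt (pdt u) x t) =
        -(∫ x in (0:ℝ)..ℓ, μ x * pdt u x t ^ 2)
          - ∫ x in (0:ℝ)..ℓ, pdt u x t * pdx (pdx (fun y s => r y * pdx (pdx u) y s)) x t := by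
      rw [← intervalIntegral.integral_neg, ← intervalIntegral.integral_sub]
      · apply intervalIntegral.integral_congr_Ioo_of_le hℓ.le
        intro x hx
        linear_combination pdt u x t * hpde x hx t ht
      · exact ((hμc.mul ((continuous_slice hut t).pow 2).continuousOn).neg).intervalIntegrable_of_Icc
          hℓ.le
      · exact ((continuous_slice hut t).mul
          (continuous_slice (contDiff_pdx (contDiff_pdx hq)) t)).intervalIntegrable 0 ℓ
    have h2 : ∫ x in (0:ℝ)..ℓ, r x * (pdx (pdx u) x t * pdt (pdx (pdx u)) x t) =
        ∫ x in (0:ℝ)..ℓ, pdx (pdx (pdt u)) x t * (r x * pdx (pdx u) x t) := by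
      rw [pdt_pdx_comm (contDiff_pdx hu), pdt_pdx_comm hu]
      exact integral_congr fun x _ => by ring
    have h3 : 0 ≤ ∫ x in (0:ℝ)..ℓ, μ x * pdt u x t ^ 2 :=
      intervalIntegral.integral_nonneg hℓ.le fun x hx =>
        mul_nonneg (hμ₀.trans (hμb x hx).1) (sq_nonneg _)
    have h4 := integral_mul_pdx_pdx_sub hut hq 0 ℓ t
    rw [velocity_zero 0 hbu0, velocity_zero ℓ hbuℓ, ← pdt_pdx_comm hu] at h4
    have h0 := hbm0 t (Ioo_subset_Icc_self ht)
    have hL := hbmℓ t (Ioo_subset_Icc_self ht)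
    rw [← pdt_pdx_comm hu] at h2
    rw [h1, h2, h4]
    have e0 : pdt (pdx u) 0 t * (r 0 * pdx (pdx u) 0 t) =
        krm * (pdx u 0 t * pdt (pdx u) 0 t) + kam * pdt (pdx u) 0 t ^ 2 := by
      linear_combination -pdt (pdx u) 0 t * h0
    have eL : pdt (pdx u) ℓ t * (r ℓ * pdx (pdx u) ℓ t) =
        -(krp * (pdx u ℓ t * pdt (pdx u) ℓ t)) - kap * pdt (pdx u) ℓ t ^ 2 := by
      linear_combination -pdt (pdx u) ℓ t * hL
    linarith [mul_nonneg hkam (sq_nonneg (pdt (pdx u) 0 t)),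
      mul_nonneg hkap (sq_nonneg (pdt (pdx u) ℓ t))]
  refine ⟨fun t ht => ⟨_, key t, main t ht⟩, ?_⟩
  refine antitoneOn_of_deriv_nonpos (convex_Icc 0 T)
    (fun t _ => (key t).continuousAt.continuousWithinAt)
    (fun t _ => (key t).differentiableAt.differentiableWithinAt) fun t ht => ?_
  rw [interior_Icc] at ht
  exact (key t).deriv.trans_le (main t ht)
end

section
/- (Identity (23): derivative of the Lyapunov function.) Let λ > 0 and define the Lyapunov function L(t) = E(t) + λ J(t). Then for every t ∈ (0,T), dL(t)/dt + 2λ E(t) = −∫₀^ℓ [μ(x) − 2λ m(x)] u_t(x,t)² dx − k_a⁻ u_xt(0,t)² − k_a⁺ u_xt(ℓ,t)². -/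
open Set intervalIntegral

noncomputable def beamJ (m μ : ℝ → ℝ) (kam kap ℓ : ℝ) (u : ℝ → ℝ → ℝ) (t : ℝ) : ℝ :=
  (∫ x in (0:ℝ)..ℓ, m x * u x t * pdt u x t)
    + (1/2) * (∫ x in (0:ℝ)..ℓ, μ x * (u x t)^2)
    + (1/2) * kam * (pdx u 0 t)^2 + (1/2) * kap * (pdx u ℓ t)^2

open Function in
theorem hasDerivAt_pdx_s13 {u : ℝ → ℝ → ℝ} (hu : ContDiff ℝ (⊤ : ℕ∞) (uncurry u)) (x t : ℝ) :
    HasDerivAt (fun y => u y t) (pdx u x t) x := by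
  have h : Differentiable ℝ (fun y => uncurry u (y, t)) :=
    (hu.differentiable (by simp)).comp (by fun_prop)
  exact (h x).hasDerivAt

open Function in
theorem hasDerivAt_pdt_s13 {u : ℝ → ℝ → ℝ} (hu : ContDiff ℝ (⊤ : ℕ∞) (uncurry u)) (x t : ℝ) :
    HasDerivAt (fun s => u x s) (pdt u x t) t := by
  have h : Differentiable ℝ (fun s => uncurry u (x, s)) :=
    (hu.differentiable (by simp)).comp (by fun_prop)
  exact (h t).hasDerivAt

open Function in
theorem pdx_eq_fderiv_s13 {u : ℝ → ℝ → ℝ} (hu : ContDiff ℝ (⊤ : ℕ∞) (uncurry u)) (x t : ℝ) :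
    pdx u x t = fderiv ℝ (uncurry u) (x, t) (1, 0) := by
  have h := ((hu.differentiable (by simp)) (x, t)).hasFDerivAt.comp_hasDerivAt x
    ((hasDerivAt_id x).prodMk (hasDerivAt_const x t))
  exact h.deriv

open Function in
theorem pdt_eq_fderiv_s13 {u : ℝ → ℝ → ℝ} (hu : ContDiff ℝ (⊤ : ℕ∞) (uncurry u)) (x t : ℝ) :
    pdt u x t = fderiv ℝ (uncurry u) (x, t) (0, 1) := by
  have h := ((hu.differentiable (by simp)) (x, t)).hasFDerivAt.comp_hasDerivAt t
    ((hasDerivAt_const t x).prodMk (hasDerivAt_id t))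
  exact h.deriv

open Function in
theorem contDiff_pdx_s13 {u : ℝ → ℝ → ℝ} (hu : ContDiff ℝ (⊤ : ℕ∞) (uncurry u)) :
    ContDiff ℝ (⊤ : ℕ∞) (uncurry (pdx u)) := by
  have h : uncurry (pdx u) = fun p => fderiv ℝ (uncurry u) p (1, 0) :=
    funext fun p => pdx_eq_fderiv_s13 hu p.1 p.2
  rw [h]
  exact (hu.fderiv_right (by simp)).clm_apply contDiff_const

open Function in
theorem contDiff_pdt_s13 {u : ℝ → ℝ → ℝ} (hu : ContDiff ℝ (⊤ : ℕ∞) (uncurry u)) :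
    ContDiff ℝ (⊤ : ℕ∞) (uncurry (pdt u)) := by
  have h : uncurry (pdt u) = fun p => fderiv ℝ (uncurry u) p (0, 1) :=
    funext fun p => pdt_eq_fderiv_s13 hu p.1 p.2
  rw [h]
  exact (hu.fderiv_right (by simp)).clm_apply contDiff_const

open Function in
theorem pdx_pdt_comm {u : ℝ → ℝ → ℝ} (hu : ContDiff ℝ (⊤ : ℕ∞) (uncurry u)) :
    pdx (pdt u) = pdt (pdx u) := by
  funext x t
  have hd : DifferentiableAt ℝ (fderiv ℝ (uncurry u)) (x, t) :=
    (hu.fderiv_right (m := (⊤ : ℕ∞)) (by simp)).differentiable (by simp) (x, t)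
  have hx : uncurry (pdx u) = fun p => fderiv ℝ (uncurry u) p (1, 0) :=
    funext fun p => pdx_eq_fderiv_s13 hu p.1 p.2
  have ht : uncurry (pdt u) = fun p => fderiv ℝ (uncurry u) p (0, 1) :=
    funext fun p => pdt_eq_fderiv_s13 hu p.1 p.2
  rw [pdx_eq_fderiv_s13 (contDiff_pdt_s13 hu), pdt_eq_fderiv_s13 (contDiff_pdx_s13 hu), hx, ht,
    fderiv_clm_apply hd (by fun_prop), fderiv_clm_apply hd (by fun_prop)]
  have hs : IsSymmSndFDerivAt ℝ (uncurry u) (x, t) :=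
    hu.contDiffAt.isSymmSndFDerivAt (by simpa using WithTop.coe_le_coe.2 (le_top (a := (2 : ℕ∞))))
  simpa using hs (1, 0) (0, 1)

open Function in
/-- Differentiation under the integral sign, with a time-independent continuous weight. -/
theorem hasDerivAt_integral_weight_mul_s13 {a b : ℝ} {f : ℝ → ℝ} {g g' : ℝ → ℝ → ℝ}
    (hf : ContinuousOn f (uIcc a b)) (hg : Continuous (uncurry g))
    (hg' : Continuous (uncurry g')) (hgg' : ∀ x s, HasDerivAt (g x) (g' x s) s) (t : ℝ) :
    HasDerivAt (fun s => ∫ x in a..b, f x * g x s) (∫ x in a..b, f x * g' x t) t := by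
  have hgx : ∀ s, Continuous fun x => g x s :=
    fun s => hg.comp (by fun_prop : Continuous fun x => (x, s))
  have hgx' : ∀ s, Continuous fun x => g' x s :=
    fun s => hg'.comp (by fun_prop : Continuous fun x => (x, s))
  have hi : ∀ s, IntervalIntegrable (fun x => f x * g x s) MeasureTheory.volume a b := fun s =>
    (hf.mul (hgx s).continuousOn).intervalIntegrable
  have hi' : ∀ s, IntervalIntegrable (fun x => f x * g' x s) MeasureTheory.volume a b := fun s =>
    (hf.mul (hgx' s).continuousOn).intervalIntegrable
  have hK : IsCompact (uIcc a b ×ˢ Metric.closedBall t 1) :=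
    isCompact_uIcc.prod (isCompact_closedBall t 1)
  obtain ⟨C, hC⟩ := hK.exists_bound_of_continuousOn (f := fun p : ℝ × ℝ => f p.1 * g' p.1 p.2)
    ((hf.comp continuousOn_fst fun p hp => hp.1).mul hg'.continuousOn)
  refine (intervalIntegral.hasDerivAt_integral_of_dominated_loc_of_deriv_le
    (F' := fun s x => f x * g' x s) (bound := fun _ => C) (Metric.ball_mem_nhds t one_pos)
    (Filter.Eventually.of_forall fun s => (hi s).def'.aestronglyMeasurable) (hi t)
    (hi' t).def'.aestronglyMeasurable ?_ intervalIntegrable_const ?_).2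
  · exact Filter.Eventually.of_forall fun x hx s hs =>
      hC (x, s) ⟨uIoc_subset_uIcc hx, Metric.ball_subset_closedBall hs⟩
  · exact Filter.Eventually.of_forall fun x _ s _ => (hgg' x s).const_mul (f x)

/-- Integrating by parts twice against a function vanishing at both endpoints. -/
theorem integral_deriv_deriv_mul_of_vanish {a b : ℝ} {q q' q'' v v' v'' : ℝ → ℝ}
    (hq : ∀ x, HasDerivAt q (q' x) x) (hq' : ∀ x, HasDerivAt q' (q'' x) x)
    (hv : ∀ x, HasDerivAt v (v' x) x) (hv' : ∀ x, HasDerivAt v' (v'' x) x)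
    (hq'' : Continuous q'') (hv'' : Continuous v'') (ha : v a = 0) (hb : v b = 0) :
    ∫ x in a..b, q'' x * v x = q a * v' a - q b * v' b + ∫ x in a..b, q x * v'' x := by
  have cq' : Continuous q' := continuous_iff_continuousAt.2 fun x => (hq' x).continuousAt
  have cv' : Continuous v' := continuous_iff_continuousAt.2 fun x => (hv' x).continuousAt
  have h₁ := integral_mul_deriv_eq_deriv_mul (a := a) (b := b) (fun x _ => hv x)
    (fun x _ => hq' x) (cv'.intervalIntegrable a b) (hq''.intervalIntegrable a b)
  have h₂ := integral_mul_deriv_eq_deriv_mul (a := a) (b := b) (fun x _ => hq x)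
    (fun x _ => hv' x) (cq'.intervalIntegrable a b) (hv''.intervalIntegrable a b)
  rw [ha, hb] at h₁
  simp only [mul_comm (q'' _), h₁, h₂, mul_comm (v' _) (q' _)]
  ring

theorem lyapunov_derivative_identity
    (ℓ T m₀ m₁ μ₀ μ₁ r₀ r₁ krm kam krp kap : ℝ)
    (m μ r : ℝ → ℝ) (u : ℝ → ℝ → ℝ)
    (hℓ : 0 < ℓ) (hT : 0 < T)
    (hm₀ : 0 < m₀) (hμ₀ : 0 ≤ μ₀) (hr₀ : 0 < r₀)
    (hmc : ContinuousOn m (Icc 0 ℓ)) (hμc : ContinuousOn μ (Icc 0 ℓ))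
    (hrc : ContinuousOn r (Icc 0 ℓ))
    (hmb : ∀ x ∈ Icc 0 ℓ, m₀ ≤ m x ∧ m x ≤ m₁)
    (hμb : ∀ x ∈ Icc 0 ℓ, μ₀ ≤ μ x ∧ μ x ≤ μ₁)
    (hrb : ∀ x ∈ Icc 0 ℓ, r₀ ≤ r x ∧ r x ≤ r₁)
    (hkrm : 0 ≤ krm) (hkam : 0 ≤ kam) (hkrp : 0 ≤ krp) (hkap : 0 ≤ kap)
    (hu : ContDiff ℝ (⊤ : ℕ∞) (Function.uncurry u))
    (hq : ContDiff ℝ (⊤ : ℕ∞) (Function.uncurry (fun x t => r x * pdx (pdx u) x t)))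
    (hpde : ∀ x ∈ Ioo 0 ℓ, ∀ t ∈ Ioo 0 T,
      m x * pdt (pdt u) x t + μ x * pdt u x t
        + pdx (pdx (fun y s => r y * pdx (pdx u) y s)) x t = 0)
    (hbu0 : ∀ t ∈ Icc 0 T, u 0 t = 0)
    (hbuℓ : ∀ t ∈ Icc 0 T, u ℓ t = 0)
    (hbm0 : ∀ t ∈ Icc 0 T,
      -(r 0 * pdx (pdx u) 0 t) = -(krm * pdx u 0 t) - kam * pdt (pdx u) 0 t)
    (hbmℓ : ∀ t ∈ Icc 0 T,
      -(r ℓ * pdx (pdx u) ℓ t) = krp * pdx u ℓ t + kap * pdt (pdx u) ℓ t)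
    (lam : ℝ) (hlam : 0 < lam) :
    ∀ t ∈ Ioo 0 T,
      ∃ d, HasDerivAt (fun s => beamEnergy m r krm krp ℓ u s + lam * beamJ m μ kam kap ℓ u s) d t ∧
        d + 2 * lam * beamEnergy m r krm krp ℓ u t
          = -(∫ x in (0:ℝ)..ℓ, (μ x - 2 * lam * m x) * (pdt u x t)^2)
              - kam * (pdt (pdx u) 0 t)^2 - kap * (pdt (pdx u) ℓ t)^2 := by
  intro t ht
  have hut := contDiff_pdt_s13 hu
  have hutt := contDiff_pdt_s13 hut
  have hux := contDiff_pdx_s13 hu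
  have huxx := contDiff_pdx_s13 hux
  have huxxt := contDiff_pdt_s13 huxx
  have hqx := contDiff_pdx_s13 hq
  have hqxx := contDiff_pdx_s13 hqx
  have cu := hu.continuous
  have cut := hut.continuous
  have cutt := hutt.continuous
  have cuxx := huxx.continuous
  have cuxxt := huxxt.continuous
  have cqxx := hqxx.continuous
  have slice : ∀ {g : ℝ → ℝ → ℝ}, Continuous (Function.uncurry g) →
      ∀ s, Continuous fun x => g x s :=
    fun hg s => hg.comp (by fun_prop : Continuous fun x => (x, s))
  rw [← uIcc_of_le hℓ.le] at hmc hμc hrc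
  have ii : ∀ {f g : ℝ → ℝ}, ContinuousOn f (uIcc 0 ℓ) → Continuous g →
      IntervalIntegrable (fun x => f x * g x) MeasureTheory.volume 0 ℓ :=
    fun hf hg => (hf.mul hg.continuousOn).intervalIntegrable
  have su := slice cu t
  have sut := slice cut t
  have sutt := slice cutt t
  have sqxx := slice cqxx t
  have ibp : ∀ {v : ℝ → ℝ → ℝ}, ContDiff ℝ (⊤ : ℕ∞) (Function.uncurry v) → v 0 t = 0 → v ℓ t = 0 →
      (∫ x in (0:ℝ)..ℓ, m x * (v x t * pdt (pdt u) x t)) +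
        (∫ x in (0:ℝ)..ℓ, μ x * (v x t * pdt u x t)) +
        (r 0 * pdx (pdx u) 0 t * pdx v 0 t - r ℓ * pdx (pdx u) ℓ t * pdx v ℓ t +
          ∫ x in (0:ℝ)..ℓ, r x * (pdx (pdx u) x t * pdx (pdx v) x t)) = 0 := by
    intro v hv h0 hl
    have sv := slice hv.continuous t
    have h := integral_deriv_deriv_mul_of_vanish (a := 0) (b := ℓ)
      (hasDerivAt_pdx_s13 hq · t) (hasDerivAt_pdx_s13 hqx · t) (hasDerivAt_pdx_s13 hv · t)
      (hasDerivAt_pdx_s13 (contDiff_pdx_s13 hv) · t) sqxx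
      (slice (contDiff_pdx_s13 (contDiff_pdx_s13 hv)).continuous t) h0 hl
    simp only [mul_assoc] at h ⊢
    rw [← h, ← integral_add (ii hmc (sv.fun_mul sutt)) (ii hμc (sv.fun_mul sut)),
      ← integral_add ((ii hmc (sv.fun_mul sutt)).add (ii hμc (sv.fun_mul sut)))
        ((sqxx.fun_mul sv).intervalIntegrable _ _),
      integral_of_le hℓ.le, MeasureTheory.integral_Ioc_eq_integral_Ioo]
    refine MeasureTheory.setIntegral_eq_zero_of_forall_eq_zero fun x hx => ?_
    linear_combination v x t * hpde x hx t ht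
  have hloc : ∀ y, (∀ s ∈ Icc 0 T, u y s = 0) → pdt u y t = 0 := by
    intro y hy
    have : (fun s => u y s) =ᶠ[nhds t] fun _ => 0 := by
      filter_upwards [Ioo_mem_nhds ht.1 ht.2] with s hs using hy s (Ioo_subset_Icc_self hs)
    simpa [pdt] using this.deriv_eq
  have htI := Ioo_subset_Icc_self ht
  have e₁ := ibp hut (hloc 0 hbu0) (hloc ℓ hbuℓ)
  have e₂ := ibp hu (hbu0 t htI) (hbuℓ t htI)
  rw [pdx_pdt_comm hu, pdx_pdt_comm hux] at e₁
  have d₁ := hasDerivAt_integral_weight_mul_s13 hmc (g := fun x s => pdt u x s ^ 2)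
    (g' := fun x s => 2 * (pdt u x s * pdt (pdt u) x s)) (cut.fun_pow 2)
    (continuous_const.fun_mul (cut.fun_mul cutt))
    (fun x s => ((hasDerivAt_pdt_s13 hut x s).fun_pow 2).congr_deriv (by ring)) t
  have d₂ := hasDerivAt_integral_weight_mul_s13 hrc (g := fun x s => pdx (pdx u) x s ^ 2)
    (g' := fun x s => 2 * (pdx (pdx u) x s * pdt (pdx (pdx u)) x s)) (cuxx.fun_pow 2)
    (continuous_const.fun_mul (cuxx.fun_mul cuxxt))
    (fun x s => ((hasDerivAt_pdt_s13 huxx x s).fun_pow 2).congr_deriv (by ring)) t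
  have d₃ := hasDerivAt_integral_weight_mul_s13 hmc (g := fun x s => u x s * pdt u x s)
    (g' := fun x s => pdt u x s ^ 2 + u x s * pdt (pdt u) x s) (cu.fun_mul cut)
    ((cut.fun_pow 2).fun_add (cu.fun_mul cutt))
    (fun x s => ((hasDerivAt_pdt_s13 hu x s).mul (hasDerivAt_pdt_s13 hut x s)).congr_deriv (by ring)) t
  have d₄ := hasDerivAt_integral_weight_mul_s13 hμc (g := fun x s => u x s ^ 2)
    (g' := fun x s => 2 * (u x s * pdt u x s)) (cu.fun_pow 2)
    (continuous_const.fun_mul (cu.fun_mul cut))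
    (fun x s => ((hasDerivAt_pdt_s13 hu x s).fun_pow 2).congr_deriv (by ring)) t
  have d₅ := (hasDerivAt_pdt_s13 hux 0 t).fun_pow 2
  have d₆ := (hasDerivAt_pdt_s13 hux ℓ t).fun_pow 2
  have split : ∀ s, beamEnergy m r krm krp ℓ u s =
      (1/2) * ((∫ x in (0:ℝ)..ℓ, m x * pdt u x s ^ 2) +
        ∫ x in (0:ℝ)..ℓ, r x * pdx (pdx u) x s ^ 2)
      + (1/2) * krm * (pdx u 0 s)^2 + (1/2) * krp * (pdx u ℓ s)^2 := fun s => by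
    rw [beamEnergy, integral_add (ii hmc ((slice cut s).fun_pow 2)) (ii hrc ((slice cuxx s).fun_pow 2))]
  have hE := (((d₁.add d₂).const_mul (1/2)).add (d₅.const_mul ((1/2) * krm))).add
    (d₆.const_mul ((1/2) * krp))
  have hJ := ((d₃.add (d₄.const_mul (1/2))).add (d₅.const_mul ((1/2) * kam))).add
    (d₆.const_mul ((1/2) * kap))
  refine ⟨_, (hE.add (hJ.const_mul lam)).congr_of_eventuallyEq
    (Filter.Eventually.of_forall fun s => ?_), ?_⟩
  · simp [split, beamJ, mul_assoc]
  · have i₃ : ∫ x in (0:ℝ)..ℓ, m x * (pdt u x t ^ 2 + u x t * pdt (pdt u) x t) =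
        (∫ x in (0:ℝ)..ℓ, m x * pdt u x t ^ 2) +
          ∫ x in (0:ℝ)..ℓ, m x * (u x t * pdt (pdt u) x t) := by
      simp only [mul_add]
      exact integral_add (ii hmc (sut.fun_pow 2)) (ii hmc (su.fun_mul sutt))
    have i₄ : ∫ x in (0:ℝ)..ℓ, (μ x - 2 * lam * m x) * pdt u x t ^ 2 =
        (∫ x in (0:ℝ)..ℓ, μ x * pdt u x t ^ 2) -
          2 * lam * ∫ x in (0:ℝ)..ℓ, m x * pdt u x t ^ 2 := by
      simp only [sub_mul, mul_assoc (2 * lam)]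
      rw [integral_sub (ii hμc (sut.fun_pow 2)) ((ii hmc (sut.fun_pow 2)).const_mul _),
        integral_const_mul]
    rw [split, i₃, i₄]
    simp only [mul_left_comm _ (2 : ℝ), integral_const_mul, ← sq] at e₁ e₂ ⊢
    have b₀ := hbm0 t htI
    have b₁ := hbmℓ t htI
    push_cast
    linear_combination e₁ + lam * e₂ + (pdt (pdx u) 0 t + lam * pdx u 0 t) * b₀
      - (pdt (pdx u) ℓ t + lam * pdx u ℓ t) * b₁
end
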